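/- (Theorem 2, graph version in Minkowski space.) Let Ω ⊆ ℝ^d be a bounded open set, F : ℝ × ℝ^d → ℝ a C¹ function, and u : ℝ^d → ℝ a C¹ function with sup_{x ∈ Ω} ‖∇u(x)‖ < 1, so that the graph {(u(x), x) : x ∈ Ω} is a spacelike hypersurface in Minkowski space ℝ × ℝ^d with induced volume element √(1 − ‖∇u(x)‖²) dx. For a C¹ function w with ‖∇w‖ < 1 on Ω define the functional W_G(w) := ∫_Ω G(w(x), x) √(1 − ‖∇w(x)‖²) dx. Assume F(u(x), x) ≠ 0 for every x ∈ Ω. If u is a critical point of W_F, i.e. for every smooth compactly supported φ : Ω → ℝ the function ε ↦ W_F(u + εφ) has derivative 0 at ε = 0, then u is also a critical point of W_{|F|}: for every smooth compactly supported φ : Ω → ℝ, the function ε ↦ W_{|F|}(u + εφ) has derivative 0 at ε = 0. -/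

import Mathlib

open MeasureTheory

/-- The functional `W_G(w) = ∫_Ω G(w(x), x) √(1 − ‖∇w(x)‖²) dx`, the integral of `G`
over the graph hypersurface `t = w(x)` in Minkowski space `ℝ × ℝᵈ` with respect to
the induced volume element. -/
noncomputable def Wfun {d : ℕ} (G : ℝ × EuclideanSpace ℝ (Fin d) → ℝ)
    (Ω : Set (EuclideanSpace ℝ (Fin d))) (w : EuclideanSpace ℝ (Fin d) → ℝ) : ℝ :=
  ∫ x in Ω, G (w x, x) * Real.sqrt (1 - ‖gradient w x‖ ^ 2)

/-- Restricting a smooth function to one of two disjoint open sets covering its support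
keeps it smooth. -/
theorem ContDiff.indicator_of_tsupport_subset_union {E : Type*} [NormedAddCommGroup E]
    [NormedSpace ℝ E] {n : WithTop ℕ∞} {f : E → ℝ} (hf : ContDiff ℝ n f) {A B : Set E}
    (hA : IsOpen A) (hB : IsOpen B) (hAB : Disjoint A B) (hsupp : tsupport f ⊆ A ∪ B) :
    ContDiff ℝ n (A.indicator f) := by
  rw [contDiff_iff_contDiffAt]
  intro x
  by_cases hx : x ∈ tsupport f
  · rcases hsupp hx with hxA | hxB
    · refine hf.contDiffAt.congr_of_eventuallyEq ?_
      filter_upwards [hA.mem_nhds hxA] with y hy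
      exact Set.indicator_of_mem hy f
    · refine (contDiffAt_const (c := (0 : ℝ))).congr_of_eventuallyEq ?_
      filter_upwards [hB.mem_nhds hxB] with y hy
      exact Set.indicator_of_notMem (Set.disjoint_right.mp hAB hy) f
  · refine (contDiffAt_const (c := (0 : ℝ))).congr_of_eventuallyEq ?_
    filter_upwards [(isClosed_tsupport f).isOpen_compl.mem_nhds hx] with y hy
    have hy0 : f y = 0 := image_eq_zero_of_notMem_tsupport hy
    simp [hy0]

theorem tsupport_indicator_subset {X : Type*} [TopologicalSpace X] (A : Set X) (f : X → ℝ) :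
    tsupport (A.indicator f) ⊆ tsupport f :=
  closure_mono (by rw [Set.support_indicator]; exact Set.inter_subset_right)

theorem ContDiff.continuous_gradient {E : Type*} [NormedAddCommGroup E]
    [InnerProductSpace ℝ E] [CompleteSpace E] {w : E → ℝ} (hw : ContDiff ℝ 1 w) :
    Continuous (gradient w) :=
  (InnerProductSpace.toDual ℝ E).symm.continuous.comp (hw.continuous_fderiv one_ne_zero)

theorem integrableOn_Wfun_integrand {d : ℕ} {G : ℝ × EuclideanSpace ℝ (Fin d) → ℝ}
    (hG : Continuous G) {Ω : Set (EuclideanSpace ℝ (Fin d))} (hΩ : Bornology.IsBounded Ω)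
    {w : EuclideanSpace ℝ (Fin d) → ℝ} (hw : ContDiff ℝ 1 w) :
    IntegrableOn (fun x => G (w x, x) * Real.sqrt (1 - ‖gradient w x‖ ^ 2)) Ω := by
  have hgrad := hw.continuous_gradient
  have hwc := hw.continuous
  have hcont : Continuous fun x => G (w x, x) * Real.sqrt (1 - ‖gradient w x‖ ^ 2) := by
    fun_prop
  exact (hcont.continuousOn.integrableOn_compact hΩ.isCompact_closure).mono_set subset_closure

theorem gradient_add_mul_congr {E : Type*} [NormedAddCommGroup E] [InnerProductSpace ℝ E]
    [CompleteSpace E] (u : E → ℝ) {φ ψ : E → ℝ} {A : Set E} (hA : IsOpen A)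
    (h : Set.EqOn φ ψ A) (ε : ℝ) {x : E} (hx : x ∈ A) :
    gradient (fun y => u y + ε * φ y) x = gradient (fun y => u y + ε * ψ y) x := by
  have heq : (fun y => u y + ε * φ y) =ᶠ[nhds x] fun y => u y + ε * ψ y := by
    filter_upwards [hA.mem_nhds hx] with y hy
    rw [h hy]
  rw [gradient, gradient, heq.fderiv_eq]

/-- For small variations with compact support in a set where `F (u x, x) ≠ 0`, the sign of
`F` along the varied graph is that of `F` along the original graph. -/
theorem eventually_forall_mul_pos {E : Type*} [TopologicalSpace E] {F : ℝ × E → ℝ}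
    (hF : Continuous F) {u φ : E → ℝ} (hu : Continuous u) (hφ : Continuous φ) {Ω : Set E}
    (hne : ∀ x ∈ Ω, F (u x, x) ≠ 0) (hc : HasCompactSupport φ) (hsupp : tsupport φ ⊆ Ω) :
    ∀ᶠ ε in nhds (0 : ℝ), ∀ x ∈ Ω, 0 < F (u x + ε * φ x, x) * F (u x, x) := by
  have hK : ∀ᶠ ε in nhds (0 : ℝ), ∀ x ∈ tsupport φ,
      0 < F (u x + ε * φ x, x) * F (u x, x) := by
    refine IsCompact.eventually_forall_of_forall_eventually hc fun x hx => ?_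
    have hcont : Continuous fun z : ℝ × E =>
        F (u z.2 + z.1 * φ z.2, z.2) * F (u z.2, z.2) := by fun_prop
    refine hcont.continuousAt.eventually_const_lt ?_
    simpa using hne x (hsupp hx)
  filter_upwards [hK] with ε hε x hx
  by_cases hxs : x ∈ tsupport φ
  · exact hε x hxs
  · simpa [image_eq_zero_of_notMem_tsupport hxs] using hne x hx

/-- Theorem 2 (graph version in Minkowski space): if the spacelike graph `t = u(x)`
over a bounded open set `Ω` is a critical point of `W_F` (under compactly supported
variations of the embedding), and `F` does not vanish on the graph, then it is also a
critical point of `W_{|F|}`. -/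
theorem critical_point_abs {d : ℕ}
    (Ω : Set (EuclideanSpace ℝ (Fin d))) (hΩ_open : IsOpen Ω)
    (hΩ_bdd : Bornology.IsBounded Ω)
    (F : ℝ × EuclideanSpace ℝ (Fin d) → ℝ) (hF : ContDiff ℝ 1 F)
    (u : EuclideanSpace ℝ (Fin d) → ℝ) (hu : ContDiff ℝ 1 u)
    (hspacelike : ∃ c : ℝ, c < 1 ∧ ∀ x ∈ Ω, ‖gradient u x‖ ≤ c)
    (hFne : ∀ x ∈ Ω, F (u x, x) ≠ 0)
    (hcrit : ∀ φ : EuclideanSpace ℝ (Fin d) → ℝ, ContDiff ℝ (⊤ : ℕ∞) φ →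
      HasCompactSupport φ → tsupport φ ⊆ Ω →
      HasDerivAt (fun ε : ℝ => Wfun F Ω (fun x => u x + ε * φ x)) 0 0) :
    ∀ φ : EuclideanSpace ℝ (Fin d) → ℝ, ContDiff ℝ (⊤ : ℕ∞) φ →
      HasCompactSupport φ → tsupport φ ⊆ Ω →
      HasDerivAt (fun ε : ℝ => Wfun (fun p => |F p|) Ω (fun x => u x + ε * φ x)) 0 0 := by
  intro φ hφ hφc hφΩ
  have hFc := hF.continuous
  have huc := hu.continuous
  have hgraph : Continuous fun x => F (u x, x) := by fun_prop
  set P : Set (EuclideanSpace ℝ (Fin d)) := Ω ∩ {x | 0 < F (u x, x)}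
  set N : Set (EuclideanSpace ℝ (Fin d)) := Ω ∩ {x | F (u x, x) < 0}
  have hP : IsOpen P := hΩ_open.inter (isOpen_lt continuous_const hgraph)
  have hN : IsOpen N := hΩ_open.inter (isOpen_lt hgraph continuous_const)
  have hPN : Disjoint P N :=
    Set.disjoint_left.mpr fun x hxP hxN =>
      lt_asymm (show 0 < F (u x, x) from hxP.2) hxN.2
  have hΩPN : Ω ⊆ P ∪ N := fun x hx =>
    (lt_or_gt_of_ne (hFne x hx)).elim (fun h => Or.inr ⟨hx, h⟩) fun h => Or.inl ⟨hx, h⟩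
  have hφP : ContDiff ℝ (⊤ : ℕ∞) (P.indicator φ) :=
    hφ.indicator_of_tsupport_subset_union hP hN hPN (hφΩ.trans hΩPN)
  have hφN : ContDiff ℝ (⊤ : ℕ∞) (N.indicator φ) :=
    hφ.indicator_of_tsupport_subset_union hN hP hPN.symm
      (hφΩ.trans (hΩPN.trans (Set.union_comm P N).subset))
  have hderiv : ∀ A : Set (EuclideanSpace ℝ (Fin d)), ContDiff ℝ (⊤ : ℕ∞) (A.indicator φ) →
      HasDerivAt (fun ε : ℝ => Wfun F Ω (fun x => u x + ε * A.indicator φ x)) 0 0 :=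
    fun A hA => hcrit _ hA
      (hφc.mono' ((subset_tsupport _).trans (tsupport_indicator_subset A φ)))
      ((tsupport_indicator_subset A φ).trans hφΩ)
  have hsum := ((hderiv P hφP).sub (hderiv N hφN)).add_const (Wfun (fun p => |F p|) Ω u)
  rw [sub_zero] at hsum
  refine hsum.congr_of_eventuallyEq ?_
  filter_upwards [eventually_forall_mul_pos hFc huc hφ.continuous hFne hφc hφΩ] with ε hε
  have hvar : ∀ ψ : EuclideanSpace ℝ (Fin d) → ℝ, ContDiff ℝ (⊤ : ℕ∞) ψ →
      ContDiff ℝ 1 fun x => u x + ε * ψ x := fun ψ hψ =>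
    hu.add (contDiff_const.mul (hψ.of_le (by exact_mod_cast le_top)))
  have hintP := integrableOn_Wfun_integrand hFc hΩ_bdd (hvar _ hφP)
  have hintN := integrableOn_Wfun_integrand hFc hΩ_bdd (hvar _ hφN)
  have hint := integrableOn_Wfun_integrand hFc.abs hΩ_bdd hu
  simp only [Pi.sub_apply, Wfun]
  rw [← integral_sub' hintP hintN, ← integral_add (hintP.sub hintN) hint]
  refine setIntegral_congr_fun hΩ_open.measurableSet fun x hx => ?_
  have hzero : ∀ A B : Set (EuclideanSpace ℝ (Fin d)), Disjoint A B →
      Set.EqOn (B.indicator φ) (fun _ => 0) A := fun A B hAB y hy =>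
    Set.indicator_of_notMem (Set.disjoint_left.mp hAB hy) φ
  have hself : ∀ A : Set (EuclideanSpace ℝ (Fin d)), Set.EqOn (A.indicator φ) φ A :=
    fun A y hy => Set.indicator_of_mem hy φ
  have hεx := hε x hx
  rcases hΩPN hx with hxP | hxN
  · have hpos : 0 < F (u x, x) := hxP.2
    have hpos' := pos_of_mul_pos_left hεx hpos.le
    simp only [Pi.sub_apply, gradient_add_mul_congr u hP (hself P) ε hxP,
      gradient_add_mul_congr u hP (hzero P N hPN) ε hxP, hself P hxP, hzero P N hPN hxP,
      mul_zero, add_zero, abs_of_pos hpos, abs_of_pos hpos']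
    ring
  · have hneg : F (u x, x) < 0 := hxN.2
    have hneg' : F (u x + ε * φ x, x) < 0 := by nlinarith
    simp only [Pi.sub_apply, gradient_add_mul_congr u hN (hself N) ε hxN,
      gradient_add_mul_congr u hN (hzero N P hPN.symm) ε hxN, hself N hxN,
      hzero N P hPN.symm hxN, mul_zero, add_zero, abs_of_neg hneg, abs_of_neg hneg']
    ring
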